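/- arXiv:2403.15400 — 2 statements merged into one kernel-verified Lean document; each statement's English description precedes it below -/
import Mathlib

section
/- (F-weighted portfolios cannot revive zero weights.) Let n ≥ 1, let m : Fin n → ℕ → ℝ be increments with m r s > 0 for all r and all s ≥ 1, and for b in the standard simplex of ℝ^n define M_t(b) := ∏_{s=1}^{t} (∑_r b_r · m r s). Let F be a probability distribution supported on a finite nonempty set S of vectors in the standard simplex, assigning each element of S strictly positive mass, and define the F-weighted weight vector at time t by b_t := (∑_{b ∈ S} b · M_{t-1}(b) · F(b)) / (∑_{b ∈ S} M_{t-1}(b) · F(b)). Then for every t ≥ 1 and every coordinate r: (b_t)_r > 0 if and only if there exists b ∈ S with b_r > 0. In particular, the set of coordinates of b_t that are zero is the same for every t, so a coordinate whose weight is zero at some time has weight zero at all times. -/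
open Finset

/-- An average of positive numbers with weights in the standard simplex is positive. -/
theorem sum_mul_pos_of_mem_simplex {ι : Type*} [Fintype ι] {w x : ι → ℝ}
    (hw : ∀ i, 0 ≤ w i) (hw1 : ∑ i, w i = 1) (hx : ∀ i, 0 < x i) :
    0 < ∑ i, w i * x i := by
  obtain ⟨i, -, hi⟩ : ∃ i ∈ Finset.univ, 0 < w i :=
    (Finset.sum_pos_iff_of_nonneg fun i _ => hw i).1 (hw1 ▸ one_pos)
  exact Finset.sum_pos' (fun j _ => mul_nonneg (hw j) (hx j).le)
    ⟨i, Finset.mem_univ i, mul_pos hi (hx i)⟩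

/-- A coordinate of a positively weighted average of nonnegative vectors is nonnegative, and it is
positive exactly when that coordinate is positive for one of the vectors. -/
theorem weighted_average_apply_nonneg_and_pos_iff {ι : Type*} {S : Finset (ι → ℝ)}
    (hS : S.Nonempty) (hnonneg : ∀ b ∈ S, ∀ i, 0 ≤ b i) {w : (ι → ℝ) → ℝ}
    (hw : ∀ b ∈ S, 0 < w b) (i : ι) :
    0 ≤ ((∑ b ∈ S, w b)⁻¹ • ∑ b ∈ S, w b • b) i ∧
      (0 < ((∑ b ∈ S, w b)⁻¹ • ∑ b ∈ S, w b • b) i ↔ ∃ b ∈ S, 0 < b i) := by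
  have hterm : ∀ b ∈ S, 0 ≤ w b * b i := fun b hb =>
    mul_nonneg (hw b hb).le (hnonneg b hb i)
  have htotal : 0 < (∑ b ∈ S, w b)⁻¹ := inv_pos.2 (Finset.sum_pos hw hS)
  simp only [Pi.smul_apply, Finset.sum_apply, smul_eq_mul]
  refine ⟨mul_nonneg htotal.le (Finset.sum_nonneg hterm), ?_⟩
  rw [mul_pos_iff_of_pos_left htotal, Finset.sum_pos_iff_of_nonneg hterm]
  exact exists_congr fun b => and_congr_right fun hb => mul_pos_iff_of_pos_left (hw b hb)

/-- **F-weighted portfolios cannot revive zero weights.** For strictly positive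
increments, a probability distribution `F` with strictly positive mass on a finite
nonempty set `S` of simplex vectors, and the `F`-weighted portfolio update
`b_t = (∑_{b ∈ S} b · M_{t-1}(b) · F(b)) / (∑_{b ∈ S} M_{t-1}(b) · F(b))`,
the `r`-th coordinate of `b_t` is positive iff some `b ∈ S` has positive `r`-th
coordinate; in particular the set of zero coordinates of `b_t` is the same for all
`t ≥ 1`. -/
theorem F_weighted_no_revival (n : ℕ) (hn : 1 ≤ n) (m : Fin n → ℕ → ℝ)
    (hm : ∀ (r : Fin n) (s : ℕ), 1 ≤ s → 0 < m r s)
    (S : Finset (Fin n → ℝ)) (hS : S.Nonempty)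
    (hSsimplex : ∀ b ∈ S, (∀ r, 0 ≤ b r) ∧ ∑ r : Fin n, b r = 1)
    (F : (Fin n → ℝ) → ℝ)
    (hFpos : ∀ b ∈ S, 0 < F b) (hFsum : ∑ b ∈ S, F b = 1)
    (M : ℕ → (Fin n → ℝ) → ℝ)
    (hM : ∀ t b, M t b = ∏ s ∈ Finset.Icc 1 t, ∑ r : Fin n, b r * m r s)
    (bt : ℕ → Fin n → ℝ)
    (hbt : ∀ t, bt t =
      (∑ b ∈ S, M (t - 1) b * F b)⁻¹ • (∑ b ∈ S, (M (t - 1) b * F b) • b)) :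
    (∀ t, 1 ≤ t → ∀ r : Fin n, (0 < bt t r ↔ ∃ b ∈ S, 0 < b r)) ∧
      (∀ t t', 1 ≤ t → 1 ≤ t' → ∀ r : Fin n, (bt t r = 0 ↔ bt t' r = 0)) := by
  have hweight : ∀ t, ∀ b ∈ S, 0 < M t b * F b := fun t b hb => by
    rw [hM]
    refine mul_pos (Finset.prod_pos fun s hs => ?_) (hFpos b hb)
    exact sum_mul_pos_of_mem_simplex (hSsimplex b hb).1 (hSsimplex b hb).2
      fun r => hm r s (Finset.mem_Icc.1 hs).1
  have key : ∀ t r, 0 ≤ bt t r ∧ (0 < bt t r ↔ ∃ b ∈ S, 0 < b r) := fun t r => by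
    rw [hbt]
    exact weighted_average_apply_nonneg_and_pos_iff hS (fun b hb => (hSsimplex b hb).1)
      (hweight (t - 1)) r
  have hzero : ∀ t r, bt t r = 0 ↔ ¬ ∃ b ∈ S, 0 < b r := fun t r => by
    rw [← (key t r).2, not_lt]
    exact ⟨le_of_eq, fun h => le_antisymm h (key t r).1⟩
  exact ⟨fun t _ r => (key t r).2, fun t t' _ _ r => (hzero t r).trans (hzero t' r).symm⟩
end

section
/- Let n ≥ 1, let m : Fin n → ℕ → ℝ be nonnegative increments, define M_{r,t} := ∏_{s=1}^{t} m r s, and suppose that at some time t the total ∑_r M_{r,t-1} is strictly positive. Then the Linear weights w_{r,t} := M_{r,t-1}, after normalization, lie in the standard simplex, and the resulting intersection increment satisfies the telescoping identity: with M_ℓ := ∏_{t'=1}^{ℓ} (∑_r w_{r,t'} m r t') / (∑_r w_{r,t'}) and assuming ∑_r M_{r,t'-1} > 0 for all t' ≤ ℓ, one has M_ℓ = (∑_r M_{r,ℓ}) / n, i.e., the Linear-weighted intersection test supermartingale equals the arithmetic mean of the base products. -/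
open Finset

/-- A telescoping product of consecutive ratios, allowing the last term to vanish. -/
theorem prod_Icc_div_pred {K : Type*} [Field K] (S : ℕ → K) (ℓ : ℕ) (h₀ : S 0 ≠ 0)
    (h : ∀ t < ℓ, S t ≠ 0) :
    ∏ t ∈ Finset.Icc 1 ℓ, S t / S (t - 1) = S ℓ / S 0 := by
  induction ℓ with
  | zero => simp [h₀]
  | succ k ih =>
    rw [Finset.prod_Icc_succ_top (by omega), ih fun t ht => h t (by omega), Nat.add_sub_cancel,
      mul_comm, div_mul_div_cancel₀ (h k (by omega))]

/-- With nonnegative increments, base products `M_{r,t} = ∏_{s=1}^t m r s` and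
Linear weights `w_{r,t} = M_{r,t-1}`: whenever the total `∑_r M_{r,t-1}` is
positive, the normalized Linear weights lie in the standard simplex, and the
Linear-weighted intersection test supermartingale telescopes to the arithmetic
mean of the base products: `M_ℓ = (∑_r M_{r,ℓ}) / n`. -/
theorem linear_weights_telescope (n : ℕ) (hn : 1 ≤ n) (m : Fin n → ℕ → ℝ)
    (hm : ∀ (r : Fin n) (s : ℕ), 1 ≤ s → 0 ≤ m r s)
    (Mb : Fin n → ℕ → ℝ)
    (hMb : ∀ r t, Mb r t = ∏ s ∈ Finset.Icc 1 t, m r s)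
    (w : Fin n → ℕ → ℝ)
    (hw : ∀ r t, w r t = Mb r (t - 1))
    (ℓ : ℕ)
    (hpos : ∀ t', 1 ≤ t' → t' ≤ ℓ → 0 < ∑ r : Fin n, Mb r (t' - 1)) :
    (∀ t', 1 ≤ t' → t' ≤ ℓ →
        (∀ r : Fin n, 0 ≤ w r t' / ∑ r' : Fin n, w r' t') ∧
          ∑ r : Fin n, w r t' / ∑ r' : Fin n, w r' t' = 1) ∧
      (∏ t' ∈ Finset.Icc 1 ℓ,
          (∑ r : Fin n, w r t' * m r t') / (∑ r : Fin n, w r t'))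
        = (∑ r : Fin n, Mb r ℓ) / n := by
  have hnonneg : ∀ r t, 0 ≤ Mb r t := fun r t => by
    rw [hMb]
    exact Finset.prod_nonneg fun s hs => hm r s (Finset.mem_Icc.1 hs).1
  have hstep : ∀ r t, 1 ≤ t → Mb r (t - 1) * m r t = Mb r t := by
    intro r t ht
    obtain ⟨k, rfl⟩ := Nat.exists_eq_add_of_le' ht
    rw [Nat.add_sub_cancel, hMb, hMb, Finset.prod_Icc_succ_top (by omega)]
  have hzero : ∑ r : Fin n, Mb r 0 = n := by simp [hMb]
  simp only [hw]
  refine ⟨fun t h₁ h₂ => ⟨fun r => div_nonneg (hnonneg _ _) (hpos t h₁ h₂).le, ?_⟩, ?_⟩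
  · rw [← Finset.sum_div, div_self (hpos t h₁ h₂).ne']
  · rw [← hzero, ← prod_Icc_div_pred (fun t => ∑ r, Mb r t) ℓ]
    · refine Finset.prod_congr rfl fun t ht => ?_
      rw [Finset.sum_congr rfl fun r _ => hstep r t (Finset.mem_Icc.1 ht).1]
    · rw [hzero]
      exact_mod_cast (by omega : n ≠ 0)
    · exact fun t ht => (hpos (t + 1) (by omega) ht).ne'
end
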